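/- Let q be a prime power, n ≥ 1, and let f_1(x) = x^{q^t}, f_2 = F, f_3 = G be q-polynomials over F_{q^n}. Let T(X,Y,Z) := ∏_{(a:b:c)∈PG(2,q)} (aX + bY + cZ) and suppose T divides F_{\underline{f}}(X,Y,Z) := det [[f_1(X), f_2(X), f_3(X)], [f_1(Y), f_2(Y), f_3(Y)], [f_1(Z), f_2(Z), f_3(Z)]] in F_{q^n}[X,Y,Z], with quotient P := F_{\underline{f}}/T. Fix λ ∈ F_{q^n}. If the bivariate polynomial P(X,Y,λ) has a factor h ∈ F_{q^n}[X,Y] of positive degree which is irreducible over the algebraic closure of F_q, such that h^2 does not divide P(X,Y,λ) and h does not divide T(X,Y,λ), then P(X,Y,Z) has a factor H ∈ F_{q^n}[X,Y,Z] of positive degree which is irreducible over the algebraic closure of F_q, such that H^2 does not divide P and H does not divide T(X,Y,Z). -/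

import Mathlib

open MvPolynomial

noncomputable section

/-- A `q`-polynomial with coefficient function `a` (supported in `[0,NB)`), applied to a
trivariate polynomial. -/
def qpoly3 (q NB : ℕ) {K : Type*} [Field K] (a : ℕ → K) (u : MvPolynomial (Fin 3) K) :
    MvPolynomial (Fin 3) K :=
  ∑ i ∈ Finset.range NB, C (a i) * u ^ q ^ i

/-- The Moore-type determinant `F_f(X,Y,Z)` for `f = (x^(q^t), f₂, f₃)`. -/
def Ff (q t NB : ℕ) {K : Type*} [Field K] (a2 a3 : ℕ → K) : MvPolynomial (Fin 3) K :=
  Matrix.det !![(X 0) ^ q ^ t, qpoly3 q NB a2 (X 0), qpoly3 q NB a3 (X 0);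
                (X 1) ^ q ^ t, qpoly3 q NB a2 (X 1), qpoly3 q NB a3 (X 1);
                (X 2) ^ q ^ t, qpoly3 q NB a2 (X 2), qpoly3 q NB a3 (X 2)]

theorem aux_factor {R S : Type*} [CommRing R] [IsDomain R] [UniqueFactorizationMonoid R]
    [CommRing S] (φ : R →+* S) (p : S) (hp : Prime p) (a : R) :
    a ≠ 0 → p ∣ φ a → ∃ g, Irreducible g ∧ g ∣ a ∧ p ∣ φ g := by
  induction a using UniqueFactorizationMonoid.induction_on_prime with
  | h₁ => intro h; exact absurd rfl h
  | h₂ x hx =>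
    intro _ hd
    exact absurd (isUnit_of_dvd_unit hd (hx.map φ)) hp.not_isUnit
  | h₃ a r ha hr ih =>
    intro _ hd
    rw [map_mul] at hd
    rcases hp.dvd_or_dvd hd with h1 | h1
    · exact ⟨r, hr.irreducible, dvd_mul_right _ _, h1⟩
    · obtain ⟨g, h2, h3, h4⟩ := ih ha h1
      exact ⟨g, h2, h3.mul_left _, h4⟩

theorem aux_fixed {K L ι : Type*} [Field K] [Field L] [Algebra K L] [IsGalois K L]
    (g : MvPolynomial ι L)
    (hg : ∀ s : L ≃ₐ[K] L, MvPolynomial.map (s : L →+* L) g = g) :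
    ∃ g0 : MvPolynomial ι K, MvPolynomial.map (algebraMap K L) g0 = g := by
  have : g ∈ Set.range (MvPolynomial.map (σ := ι) (algebraMap K L)) := by
    rw [MvPolynomial.mem_range_map_iff_coeffs_subset]
    intro c hc
    obtain ⟨m, -, rfl⟩ := MvPolynomial.mem_coeffs_iff.1 hc
    rw [InfiniteGalois.mem_range_algebraMap_iff_fixed]
    intro s
    conv_rhs => rw [← hg s]
    rw [MvPolynomial.coeff_map]; rfl
  exact this

theorem aux_mapmap {K L ι : Type*} [Field K] [Field L] [Algebra K L]
    (g : MvPolynomial ι K) (s : L ≃ₐ[K] L) :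
    MvPolynomial.map (s : L →+* L) (MvPolynomial.map (algebraMap K L) g)
      = MvPolynomial.map (algebraMap K L) g := by
  rw [MvPolynomial.map_map]
  have : (s : L →+* L).comp (algebraMap K L) = algebraMap K L := by
    ext x
    simp
  rw [this]

theorem aux_desc {K L ι : Type*} [Field K] [Field L] [Algebra K L] [IsGalois K L]
    (f g : MvPolynomial ι K)
    (hd : MvPolynomial.map (algebraMap K L) f ∣ MvPolynomial.map (algebraMap K L) g) :
    f ∣ g := by
  have inj := MvPolynomial.map_injective (σ := ι) (algebraMap K L) (algebraMap K L).injective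
  obtain ⟨r, hr⟩ := hd
  by_cases hf : f = 0
  · subst hf
    rw [map_zero, zero_mul] at hr
    rw [inj (hr.trans (map_zero _).symm)]
  · obtain ⟨r0, rfl⟩ := aux_fixed (K := K) r (by
      intro s
      have h1 := congrArg (MvPolynomial.map (s : L →+* L)) hr
      rw [map_mul, aux_mapmap, aux_mapmap, hr] at h1
      exact (mul_left_cancel₀ (fun h0 => hf (inj (h0.trans (map_zero _).symm))) h1).symm)
    rw [← map_mul] at hr
    exact ⟨r0, inj hr⟩

theorem aux_spec {R S : Type*} [Field R] [Field S] (s : R →+* S) (l : R)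
    (g : MvPolynomial (Fin 3) R) :
    MvPolynomial.map s (aeval ![X 0, X 1, C l] g : MvPolynomial (Fin 2) R)
      = aeval ![X 0, X 1, C (s l)] (MvPolynomial.map s g) := by
  induction g using MvPolynomial.induction_on with
  | C a => simp [MvPolynomial.algebraMap_eq]
  | add p q hp hq => simp only [map_add, hp, hq]
  | mul_X p i hp =>
    simp only [map_mul, hp, aeval_X, map_X]
    congr 1
    fin_cases i <;> simp

theorem aux_main {K : Type*} [Field K] [Fintype K] (l : K)
    (P T : MvPolynomial (Fin 3) K) (h : MvPolynomial (Fin 2) K)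
    (hdvd : h ∣ aeval ![X 0, X 1, C l] P)
    (hirr : Irreducible (MvPolynomial.map (algebraMap K (AlgebraicClosure K)) h))
    (hnonrep : ¬ h ^ 2 ∣ aeval ![X 0, X 1, C l] P)
    (hnotT : ¬ h ∣ aeval ![X 0, X 1, C l] T) :
    ∃ H : MvPolynomial (Fin 3) K,
      H ∣ P ∧ 0 < H.totalDegree ∧
      Irreducible (MvPolynomial.map (algebraMap K (AlgebraicClosure K)) H) ∧
      ¬ H ^ 2 ∣ P ∧ ¬ H ∣ T := by
  let L := AlgebraicClosure K
  haveI : IsGalois K L := {}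
  let ψ := algebraMap K L
  let φ : MvPolynomial (Fin 3) L →+* MvPolynomial (Fin 2) L :=
    (aeval (R := L) ![X 0, X 1, C (ψ l)]).toRingHom
  have hφ : ∀ g : MvPolynomial (Fin 3) K,
      MvPolynomial.map ψ (aeval ![X 0, X 1, C l] g : MvPolynomial (Fin 2) K)
        = φ (MvPolynomial.map ψ g) := fun g => aux_spec ψ l g
  have hP0 : P ≠ 0 := by
    rintro rfl
    exact hnonrep (by simp)
  have inj := MvPolynomial.map_injective (σ := Fin 3) ψ ψ.injective
  have hmP0 : MvPolynomial.map ψ P ≠ 0 := fun h0 => hP0 (inj (h0.trans (map_zero _).symm))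
  have hd' : MvPolynomial.map ψ h ∣ φ (MvPolynomial.map ψ P) := by
    rw [← hφ]; exact map_dvd _ hdvd
  obtain ⟨G, hGi, hGP, hGh⟩ := aux_factor φ _ hirr.prime _ hmP0 hd'
  have hsq : ∀ A B, A * B ∣ MvPolynomial.map ψ P → MvPolynomial.map ψ h ∣ φ A →
      MvPolynomial.map ψ h ∣ φ B → False := by
    intro A B hAB hA hB
    apply hnonrep
    apply aux_desc (L := L)
    change MvPolynomial.map ψ _ ∣ MvPolynomial.map ψ _
    rw [hφ, map_pow, sq]
    refine (mul_dvd_mul hA hB).trans ?_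
    rw [← map_mul]
    exact map_dvd _ hAB
  obtain ⟨m, hm⟩ := MvPolynomial.ne_zero_iff.1 hGi.ne_zero
  let c := coeff m G
  have hu : IsUnit (C (σ := Fin 3) c⁻¹) := (isUnit_iff_ne_zero.2 (inv_ne_zero hm)).map C
  let G1 := C c⁻¹ * G
  have hass : Associated G1 G := by
    have := (associated_isUnit_mul_left_iff (a := G) (b := G) hu).2 (Associated.refl _)
    exact this
  have hG1i : Irreducible G1 := hass.irreducible_iff.2 hGi
  have hG1P : G1 ∣ MvPolynomial.map ψ P := hass.dvd.trans hGP
  have hG1h : MvPolynomial.map ψ h ∣ φ G1 := hGh.trans (map_dvd φ hass.symm.dvd)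
  have hc1 : coeff m G1 = 1 := by
    simp only [G1, coeff_C_mul]; exact inv_mul_cancel₀ hm
  obtain ⟨H, hH⟩ := aux_fixed (K := K) G1 (by
    intro s
    have e1 : MvPolynomial.map (s : L →+* L) (MvPolynomial.map ψ P) = MvPolynomial.map ψ P :=
      aux_mapmap P s
    have e2 : MvPolynomial.map (s : L →+* L) (MvPolynomial.map ψ h) = MvPolynomial.map ψ h :=
      aux_mapmap h s
    have d1 : MvPolynomial.map (s : L →+* L) G1 ∣ MvPolynomial.map ψ P := by
      rw [← e1]; exact map_dvd _ hG1P
    have d2 : MvPolynomial.map ψ h ∣ φ (MvPolynomial.map (s : L →+* L) G1) := by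
      have := map_dvd (MvPolynomial.map (s : L →+* L)) hG1h
      rw [e2] at this
      have e3 := aux_spec (s : L →+* L) (ψ l) G1
      have e4 : (s : L →+* L) (ψ l) = ψ l := s.commutes l
      rw [e4] at e3
      exact this.trans (dvd_of_eq e3)
    have d3 : G1 ∣ MvPolynomial.map (s : L →+* L) G1 := by
      by_contra hnd
      obtain ⟨r, hr⟩ := d1
      have : G1 ∣ MvPolynomial.map (s : L →+* L) G1 * r := hr ▸ hG1P
      rcases hG1i.prime.dvd_or_dvd this with h1 | h1
      · exact hnd h1
      · exact hsq _ _ (by rw [hr]; exact mul_dvd_mul_left _ h1) d2 hG1h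
    obtain ⟨r, hr⟩ := d3
    have hsi : Irreducible (MvPolynomial.map (s : L →+* L) G1) := by
      have := (MulEquiv.irreducible_iff (MvPolynomial.mapEquiv (Fin 3) (s : L ≃+* L)) (x := G1)).2 hG1i
      exact this
    have hru : IsUnit r := (hsi.isUnit_or_isUnit hr).resolve_left hG1i.not_isUnit
    obtain ⟨d, -, rfl⟩ := MvPolynomial.isUnit_iff_eq_C_of_isReduced.1 hru
    have h5 := congrArg (coeff m) hr
    rw [coeff_map, mul_comm G1, hc1, coeff_C_mul, hc1, map_one, mul_one] at h5
    rw [hr, ← h5, C_1, mul_one])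
  have hHirr : Irreducible (MvPolynomial.map (algebraMap K (AlgebraicClosure K)) H) := by
    rw [show MvPolynomial.map (algebraMap K (AlgebraicClosure K)) H = G1 from hH]; exact hG1i
  refine ⟨H, aux_desc (L := L) _ _ (by rw [hH]; exact hG1P), ?_, hHirr, ?_, ?_⟩
  · rw [Nat.pos_iff_ne_zero]
    intro h0
    rw [totalDegree_eq_zero_iff_eq_C] at h0
    rw [h0, map_C] at hHirr
    refine hHirr.not_isUnit (IsUnit.map C (isUnit_iff_ne_zero.2 ?_))
    intro h1
    rw [h1, C_0] at hHirr
    exact hHirr.ne_zero rfl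
  · intro h2
    have := map_dvd (MvPolynomial.map ψ) h2
    rw [map_pow, hH, sq] at this
    exact hsq _ _ this hG1h hG1h
  · intro h2
    apply hnotT
    apply aux_desc (L := L)
    change MvPolynomial.map ψ _ ∣ MvPolynomial.map ψ _
    rw [hφ]
    have := map_dvd (MvPolynomial.map ψ) h2
    rw [hH] at this
    exact hG1h.trans (map_dvd φ this)

/-- **specialization lemma.** Suppose
`T(X,Y,Z) = ∏_{(a:b:c) ∈ PG(2,q)} (aX+bY+cZ)` divides `F_f(X,Y,Z)` with quotient `P`.
If for some `λ ∈ F_(q^n)` the bivariate polynomial `P(X,Y,λ)` has a non-repeated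
absolutely irreducible factor `h ∈ F_(q^n)[X,Y]` of positive degree not dividing
`T(X,Y,λ)`, then `P` has a non-repeated absolutely irreducible factor
`H ∈ F_(q^n)[X,Y,Z]` of positive degree not dividing `T(X,Y,Z)`. -/
theorem stmt_18 (q n t NB : ℕ) (hq : ∃ p e : ℕ, p.Prime ∧ 0 < e ∧ q = p ^ e)
    (hn : 1 ≤ n)
    (K : Type) [Field K] [Fintype K] (hK : Fintype.card K = q ^ n)
    (a2 a3 : ℕ → K) (l : K)
    -- a set of representatives of PG(2,q)
    (S : Finset (K × K × K))
    (hS1 : ∀ v ∈ S,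
      (v.1 ^ q = v.1 ∧ v.2.1 ^ q = v.2.1 ∧ v.2.2 ^ q = v.2.2) ∧ v ≠ (0, 0, 0))
    (hS2 : ∀ w : K × K × K, w.1 ^ q = w.1 → w.2.1 ^ q = w.2.1 → w.2.2 ^ q = w.2.2 →
      w ≠ (0, 0, 0) →
      ∃! v, v ∈ S ∧ ∃ μ : K, μ ^ q = μ ∧ μ ≠ 0 ∧
        w = (μ * v.1, μ * v.2.1, μ * v.2.2))
    (P : MvPolynomial (Fin 3) K)
    (hTP : Ff q t NB a2 a3
      = (∏ v ∈ S, (C v.1 * X 0 + C v.2.1 * X 1 + C v.2.2 * X 2)) * P)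
    (h : MvPolynomial (Fin 2) K)
    (hdvd : h ∣ aeval ![X 0, X 1, C l] P)
    (hdeg : 0 < h.totalDegree)
    (hirr : Irreducible (MvPolynomial.map (algebraMap K (AlgebraicClosure K)) h))
    (hnonrep : ¬ h ^ 2 ∣ aeval ![X 0, X 1, C l] P)
    (hnotT : ¬ h ∣ aeval ![X 0, X 1, C l]
      (∏ v ∈ S, (C v.1 * X 0 + C v.2.1 * X 1 + C v.2.2 * X 2))) :
    ∃ H : MvPolynomial (Fin 3) K,
      H ∣ P ∧ 0 < H.totalDegree ∧
      Irreducible (MvPolynomial.map (algebraMap K (AlgebraicClosure K)) H) ∧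
      ¬ H ^ 2 ∣ P ∧
      ¬ H ∣ ∏ v ∈ S, (C v.1 * X 0 + C v.2.1 * X 1 + C v.2.2 * X 2) := by
  exact aux_main l P _ h hdvd hirr hnonrep hnotT

end
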